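/- There exists no four-dimensional linear subspace of the ZZ_2-vector space of graphs on 9 vertices which is useful for triangles. -/

import Mathlib

/-- The edge set of the complete graph on `n` vertices. -/
abbrev Edge (n : ℕ) := {e : Sym2 (Fin n) // ¬ e.IsDiag}

/-- Graphs on `n` vertices, identified with their (indicator functions of) edge sets;
they form a vector space over `ZMod 2` under symmetric difference. -/
abbrev Kvecsp (n : ℕ) := Edge n → ZMod 2

/-- The edge joining two distinct vertices. -/
def edg {n : ℕ} (u v : Fin n) (h : u ≠ v) : Edge n :=
  ⟨s(u, v), fun hd => h (Sym2.mk_isDiag_iff.mp hd)⟩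

/-- Adjacency in a graph. -/
def KAdj {n : ℕ} (G : Kvecsp n) (u v : Fin n) : Prop :=
  ∃ h : u ≠ v, G (edg u v h) = 1

/-- The complement of a graph. -/
def Kcompl {n : ℕ} (G : Kvecsp n) : Kvecsp n := fun e => G e + 1

/-- The agreement of two graphs: the complement of their symmetric difference. -/
def agr {n : ℕ} (G₁ G₂ : Kvecsp n) : Kvecsp n := fun e => G₁ e + G₂ e + 1

/-- A graph is bipartite if its vertices can be split in two parts with all edges crossing. -/
def IsBipartite {n : ℕ} (G : Kvecsp n) : Prop :=
  ∃ s : Set (Fin n), ∀ u v : Fin n, KAdj G u v → (u ∈ s ↔ v ∉ s)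

/-- A graph contains a triangle. -/
def HasTriangle {n : ℕ} (G : Kvecsp n) : Prop :=
  ∃ u v w : Fin n, u ≠ v ∧ u ≠ w ∧ v ≠ w ∧ KAdj G u v ∧ KAdj G u w ∧ KAdj G v w

/-- A graph is triangle-free. -/
def TriangleFree {n : ℕ} (G : Kvecsp n) : Prop := ¬ HasTriangle G

/-- A family of graphs is non-bipartite-agreeing if the agreement of any two members
is not bipartite. -/
def NonBipartiteAgreeing {n : ℕ} (F : Finset (Kvecsp n)) : Prop :=
  ∀ G₁ ∈ F, ∀ G₂ ∈ F, ¬ IsBipartite (agr G₁ G₂)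
/-- A subset `V` of the space of graphs on `n` vertices, of size `2^m` for some `m ≥ 3`,
is useful for triangles if every subset of `V` of size `2^(m-3) + 1` contains two distinct
vectors whose agreement is triangle-free. -/
def UsefulForTriangles {n : ℕ} (V : Set (Kvecsp n)) : Prop :=
  ∃ m : ℕ, 3 ≤ m ∧ V.ncard = 2 ^ m ∧
    ∀ S ⊆ V, S.ncard = 2 ^ (m - 3) + 1 →
      ∃ G₁ ∈ S, ∃ G₂ ∈ S, G₁ ≠ G₂ ∧ TriangleFree (agr G₁ G₂)

def badTbl : Nat := 39485808851151138317147654547089247882259716839548430327128250780738971493879462687065973890019825083668047147467880452308083888989459445937881112178587997806261466758706174217036866139254808904957226828054461307208242671424023422020479939288485346146162712298307874315982371037693659821752406907639453532595448797639717613024142514264159305470845741938994427904081092253163906056950579155464097232266466656681805600774757919156236695290264460437986573466243507944449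

def okTbl : Nat := 1288817908631680557797982226846385275759684024320934853344650856226330017702128793253244221276139337032407286369458542250817320239623455845772766612231374269233672768152646363469020133370461465508785955820742435793966277997623766906878914949290100697730103021429389634370720386687819577432650264576

def initDom : Nat := 333172208270285293872691904647557880981062643970413170609449106553754319109775686140657429604453655265043247146188505260470272

def allItems : List (Nat × List (Nat × Nat)) := [
  (6, [(1, 13), (13, 1), (2, 20), (20, 2), (3, 27), (27, 3), (4, 34), (34, 4), (5, 41), (41, 5)]),
  (5, [(1, 12), (12, 1), (2, 19), (19, 2), (3, 26), (26, 3), (4, 33), (33, 4), (6, 41), (41, 6)]),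
  (33, [(4, 5), (5, 4), (11, 12), (12, 11), (18, 19), (19, 18), (25, 26), (26, 25), (34, 41), (41, 34)]),
  (34, [(4, 6), (6, 4), (11, 13), (13, 11), (18, 20), (20, 18), (25, 27), (27, 25), (33, 41), (41, 33)]),
  (13, [(1, 6), (6, 1), (9, 20), (20, 9), (10, 27), (27, 10), (11, 34), (34, 11), (12, 41), (41, 12)]),
  (19, [(2, 5), (5, 2), (9, 12), (12, 9), (17, 26), (26, 17), (18, 33), (33, 18), (20, 41), (41, 20)]),
  (20, [(2, 6), (6, 2), (9, 13), (13, 9), (17, 27), (27, 17), (18, 34), (34, 18), (19, 41), (41, 19)]),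
  (27, [(3, 6), (6, 3), (10, 13), (13, 10), (17, 20), (20, 17), (25, 34), (34, 25), (26, 41), (41, 26)]),
  (12, [(1, 5), (5, 1), (9, 19), (19, 9), (10, 26), (26, 10), (11, 33), (33, 11), (13, 41), (41, 13)]),
  (10, [(1, 3), (3, 1), (9, 17), (17, 9), (11, 25), (25, 11), (12, 26), (26, 12), (13, 27), (27, 13)]),
  (3, [(1, 10), (10, 1), (2, 17), (17, 2), (4, 25), (25, 4), (5, 26), (26, 5), (6, 27), (27, 6)]),
  (2, [(1, 9), (9, 1), (3, 17), (17, 3), (4, 18), (18, 4), (5, 19), (19, 5), (6, 20), (20, 6)]),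
  (1, [(2, 9), (9, 2), (3, 10), (10, 3), (4, 11), (11, 4), (5, 12), (12, 5), (6, 13), (13, 6)]),
  (4, [(1, 11), (11, 1), (2, 18), (18, 2), (3, 25), (25, 3), (5, 33), (33, 5), (6, 34), (34, 6)]),
  (18, [(2, 4), (4, 2), (9, 11), (11, 9), (17, 25), (25, 17), (19, 33), (33, 19), (20, 34), (34, 20)]),
  (25, [(3, 4), (4, 3), (10, 11), (11, 10), (17, 18), (18, 17), (26, 33), (33, 26), (27, 34), (34, 27)]),
  (17, [(2, 3), (3, 2), (9, 10), (10, 9), (18, 25), (25, 18), (19, 26), (26, 19), (20, 27), (27, 20)]),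
  (26, [(3, 5), (5, 3), (10, 12), (12, 10), (17, 19), (19, 17), (25, 33), (33, 25), (27, 41), (41, 27)]),
  (9, [(1, 2), (2, 1), (10, 17), (17, 10), (11, 18), (18, 11), (12, 19), (19, 12), (13, 20), (20, 13)]),
  (11, [(1, 4), (4, 1), (9, 18), (18, 9), (10, 25), (25, 10), (12, 33), (33, 12), (13, 34), (34, 13)]),
  (41, [(5, 6), (6, 5), (12, 13), (13, 12), (19, 20), (20, 19), (26, 27), (27, 26), (33, 34), (34, 33)])]

def permList : List (List Nat) := [
  [0, 1, 2, 3, 4, 5, 6, 7, 8, 9],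
  [0, 1, 3, 2, 4, 6, 5, 8, 7, 9],
  [0, 3, 1, 2, 6, 4, 5, 8, 9, 7],
  [7, 1, 4, 8, 2, 5, 9, 0, 3, 6],
  [8, 1, 4, 7, 3, 6, 9, 0, 2, 5],
  [8, 1, 7, 4, 3, 9, 6, 2, 0, 5],
  [8, 7, 1, 4, 9, 3, 6, 2, 5, 0],
  [3, 1, 2, 0, 8, 9, 6, 7, 4, 5],
  [1, 0, 2, 3, 4, 7, 8, 5, 6, 9],
  [1, 0, 3, 2, 4, 8, 7, 6, 5, 9],
  [1, 2, 0, 3, 7, 4, 8, 5, 9, 6],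
  [1, 2, 3, 0, 7, 8, 4, 9, 5, 6],
  [1, 3, 0, 2, 8, 4, 7, 6, 9, 5],
  [1, 3, 2, 0, 8, 7, 4, 9, 6, 5],
  [3, 0, 1, 2, 6, 8, 9, 4, 5, 7],
  [3, 1, 0, 2, 8, 6, 9, 4, 7, 5],
  [1, 4, 7, 8, 0, 2, 3, 5, 6, 9],
  [1, 4, 8, 7, 0, 3, 2, 6, 5, 9],
  [1, 7, 4, 8, 2, 0, 3, 5, 9, 6],
  [1, 7, 8, 4, 2, 3, 0, 9, 5, 6],
  [1, 8, 4, 7, 3, 0, 2, 6, 9, 5],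
  [1, 8, 7, 4, 3, 2, 0, 9, 6, 5],
  [7, 1, 8, 4, 2, 9, 5, 3, 0, 6],
  [7, 8, 1, 4, 9, 2, 5, 3, 6, 0],
  [3, 6, 8, 9, 0, 1, 2, 4, 5, 7],
  [3, 8, 6, 9, 1, 0, 2, 4, 7, 5],
  [3, 8, 9, 6, 1, 2, 0, 7, 4, 5],
  [8, 3, 6, 9, 1, 4, 7, 0, 2, 5],
  [8, 3, 9, 6, 1, 7, 4, 2, 0, 5],
  [8, 9, 3, 6, 7, 1, 4, 2, 5, 0]]

/-- Evaluate a natural number before passing it on. -/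
noncomputable def force (n : Nat) (k : Nat → Bool) : Bool :=
  Nat.rec (motive := fun _ => Bool) (k 0) (fun m _ => k (Nat.succ m)) n

theorem force_eq (n : Nat) (k : Nat → Bool) : force n k = k n := by
  cases n <;> rfl

abbrev Item := Nat × List (Nat × Nat)

def badMask (x yy : Nat) : Nat :=
  Nat.land (Nat.shiftRight badTbl (Nat.mul 10 (Nat.add (Nat.mul 16 x) yy))) 1023

def fldA (A f : Nat) : Nat := Nat.land (Nat.shiftRight A (Nat.mul 4 f)) 15

def fldD (D g : Nat) : Nat := Nat.land (Nat.shiftRight D (Nat.mul 10 g)) 1023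

def upd1 (x A D f g : Nat) : Nat :=
  Nat.xor D (Nat.land D (Nat.shiftLeft (badMask x (fldA A f)) (Nat.mul 10 g)))

def updA (x A e : Nat) : Nat := Nat.lor A (Nat.shiftLeft (Nat.succ x) (Nat.mul 4 e))

/-- Propagate the assignment of colour `x` through the adjacency list. -/
noncomputable def propagate (x A : Nat) (adj : List (Nat × Nat)) (k : Nat → Bool) : Nat → Bool :=
  List.rec (motive := fun _ => Nat → Bool) (fun D => k D)
    (fun p _ ih D => force (upd1 x A D p.1 p.2) ih) adj

noncomputable def anyZero (D : Nat) (rem : List Item) : Bool :=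
  List.rec (motive := fun _ => Bool) false
    (fun p _ ih => Bool.rec (motive := fun _ => Bool) ih true (Nat.beq (fldD D p.1) 0)) rem

noncomputable def pick (D : Nat) (dflt : Item) (rem : List Item) : Item :=
  List.rec (motive := fun _ => Item) dflt
    (fun p _ ih => Bool.rec (motive := fun _ => Item) ih p
      (Nat.beq (Nat.land (fldD D p.1) (Nat.sub (fldD D p.1) 1)) 0)) rem

noncomputable def remv (e : Nat) (rem : List Item) : List Item :=
  List.rec (motive := fun _ => List Item) []
    (fun p t ih => Bool.rec (motive := fun _ => List Item) (List.cons p ih) t (Nat.beq p.1 e)) rem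

/-- Conjunction over the colours `x < 10` in the mask `d`. -/
noncomputable def allCol (d : Nat) (k : Nat → Bool) : Bool :=
  Nat.rec (motive := fun _ => Bool) true
    (fun x ih => Bool.rec (motive := fun _ => Bool) false ih
      (Bool.rec (motive := fun _ => Bool) true (k x)
        (Nat.beq (Nat.land (Nat.shiftRight d x) 1) 1))) 10

/-- `search` returns `true` when no completion exists. -/
noncomputable def search (fuel : Nat) : List Item → Nat → Nat → Bool :=
  Nat.rec (motive := fun _ => List Item → Nat → Nat → Bool) (fun _ _ _ => false)
    (fun _ ih rem A D =>
      List.rec (motive := fun _ => Bool) false (fun p t _ =>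
        Bool.rec (motive := fun _ => Bool)
          (Prod.rec (motive := fun _ => Bool) (fun e adj =>
            allCol (fldD D e) (fun x =>
              force (updA x A e) (fun A' =>
                propagate x A adj (fun D' => ih (remv e (List.cons p t)) A' D') D)))
            (pick D p (List.cons p t)))
          true (anyZero D (List.cons p t))) rem) fuel

section Sound

variable (c : Nat → Nat)

def InvA (A : Nat) : Prop := ∀ f, fldA A f = 0 ∨ fldA A f = c f + 1

def InvD (E : Nat → Prop) (D : Nat) : Prop := ∀ g, E g → D.testBit (10 * g + c g) = true

def GoodAdj (e : Nat) (adj : List (Nat × Nat)) : Prop :=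
  ∀ q ∈ adj, (badMask (c e) 0).testBit (c q.2) = false ∧
    (badMask (c e) (c q.1 + 1)).testBit (c q.2) = false

theorem land_def (a b : Nat) : Nat.land a b = a &&& b := rfl
theorem lor_def (a b : Nat) : Nat.lor a b = a ||| b := rfl
theorem nxor_def (a b : Nat) : Nat.xor a b = a ^^^ b := rfl
theorem shr_def (a b : Nat) : Nat.shiftRight a b = a >>> b := rfl
theorem shl_def (a b : Nat) : Nat.shiftLeft a b = a <<< b := rfl

theorem tb1023 (i : Nat) : Nat.testBit 1023 i = decide (i < 10) :=
  Nat.testBit_two_pow_sub_one 10 i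

theorem tb15 (i : Nat) : Nat.testBit 15 i = decide (i < 4) :=
  Nat.testBit_two_pow_sub_one 4 i

theorem badMask_hi (x y i : Nat) (h : 10 ≤ i) : (badMask x y).testBit i = false := by
  rw [badMask, land_def, Nat.testBit_and, tb1023]
  simp; omega

theorem testBit_fldD (D g i : Nat) (h : i < 10) : (fldD D g).testBit i = D.testBit (10 * g + i) := by
  rw [fldD, land_def, Nat.testBit_and, tb1023, shr_def, Nat.testBit_shiftRight]
  simp [h]

theorem invA_upd (A e : Nat) (hc : ∀ g, c g < 10) (hA : InvA c A) :
    InvA c (updA (c e) A e) := by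
  intro f
  have key : ∀ i, (fldA (updA (c e) A e) f).testBit i =
      ((fldA A f).testBit i || (decide (f = e) && (c e + 1).testBit i)) := by
    intro i
    simp only [fldA, updA, land_def, lor_def, shr_def, shl_def, Nat.testBit_and, tb15,
      Nat.testBit_shiftRight, Nat.testBit_or, Nat.testBit_shiftLeft, Nat.mul_eq, Nat.succ_eq_add_one]
    have hbig : ∀ j, 4 ≤ j → (c e + 1).testBit j = false := by
      intro j hj
      apply Nat.testBit_lt_two_pow
      calc c e + 1 < 2 ^ 4 := by have := hc e; omega
        _ ≤ 2 ^ j := Nat.pow_le_pow_right (by norm_num) hj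
    by_cases hi : i < 4
    · rcases lt_trichotomy f e with h | h | h
      · have h1 : ¬ (4 * e ≤ 4 * f + i) := by omega
        simp [hi, h1, h.ne]
      · subst h
        simp [hi]
      · have h1 : 4 ≤ 4 * f + i - 4 * e := by omega
        simp [hi, hbig _ h1, h.ne']
    · simp [hi, hbig i (by omega)]
  by_cases hfe : f = e
  · subst hfe
    right
    apply Nat.eq_of_testBit_eq
    intro i
    rw [key]
    rcases hA f with h | h <;> simp [h]
  · have : fldA (updA (c e) A e) f = fldA A f := by
      apply Nat.eq_of_testBit_eq
      intro i
      rw [key]; simp [hfe]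
    rw [this]; exact hA f

theorem invD_upd1 (E : Nat → Prop) (A D e f g : Nat) (hc : ∀ g, c g < 10) (hA : InvA c A)
    (hD : InvD c E D)
    (h1 : (badMask (c e) 0).testBit (c g) = false)
    (h2 : (badMask (c e) (c f + 1)).testBit (c g) = false) :
    InvD c E (upd1 (c e) A D f g) := by
  intro g' hg'
  have hm : (badMask (c e) (fldA A f)).testBit (c g) = false := by
    rcases hA f with h | h <;> rw [h] <;> assumption
  have hcg := hc g
  have hcg' := hc g'
  simp only [upd1, land_def, nxor_def, shl_def, Nat.testBit_xor, Nat.testBit_and,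
    Nat.testBit_shiftLeft, hD g' hg', Nat.mul_eq]
  rcases lt_trichotomy g' g with h | h | h
  · have h3 : ¬ (10 * g ≤ 10 * g' + c g') := by omega
    simp [h3]
  · subst h
    simp [hm]
  · have h3 : 10 ≤ 10 * g' + c g' - 10 * g := by omega
    simp [badMask_hi _ _ _ h3]

theorem propagate_sound (E : Nat → Prop) (A e : Nat) (hc : ∀ g, c g < 10) (hA : InvA c A)
    (k : Nat → Bool) (hk : ∀ D, InvD c E D → k D = false) (adj : List (Nat × Nat)) :
    GoodAdj c e adj → ∀ D, InvD c E D → propagate (c e) A adj k D = false := by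
  induction adj with
  | nil => intro _ D hD; exact hk D hD
  | cons p t ih =>
    intro hg D hD
    have h0 : propagate (c e) A (p :: t) k D =
      force (upd1 (c e) A D p.1 p.2) (propagate (c e) A t k) := rfl
    rw [h0, force_eq]
    have hp := hg p (by simp)
    exact ih (fun q hq => hg q (by simp [hq])) _
      (invD_upd1 c E A D e p.1 p.2 hc hA hD hp.1 hp.2)

theorem anyZero_sound (E : Nat → Prop) (D : Nat) (hc : ∀ g, c g < 10) (hD : InvD c E D)
    (rem : List Item) (hr : ∀ p ∈ rem, E p.1) : anyZero D rem = false := by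
  induction rem with
  | nil => rfl
  | cons p t ih =>
    have h0 : anyZero D (p :: t) = Bool.rec (motive := fun _ => Bool) (anyZero D t) true
      (Nat.beq (fldD D p.1) 0) := rfl
    have h1 : Nat.beq (fldD D p.1) 0 = false := by
      rw [← Bool.not_eq_true]
      intro h
      have h := Nat.eq_of_beq_eq_true h
      have h2 := testBit_fldD D p.1 (c p.1) (hc _)
      rw [h, hD p.1 (hr p (by simp))] at h2
      simp at h2
    rw [h0, h1]
    exact ih (fun q hq => hr q (by simp [hq]))

theorem pick_mem (D : Nat) (d : Item) (rem : List Item) :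
    pick D d rem = d ∨ pick D d rem ∈ rem := by
  induction rem with
  | nil => left; rfl
  | cons p t ih =>
    have h0 : pick D d (p :: t) = Bool.rec (motive := fun _ => Item) (pick D d t) p
      (Nat.beq (Nat.land (fldD D p.1) (Nat.sub (fldD D p.1) 1)) 0) := rfl
    rw [h0]
    cases (Nat.beq (Nat.land (fldD D p.1) (Nat.sub (fldD D p.1) 1)) 0)
    · rcases ih with h | h
      · left; exact h
      · right; exact List.mem_cons_of_mem _ h
    · right; simp

theorem remv_sub (e : Nat) (rem : List Item) : ∀ p ∈ remv e rem, p ∈ rem := by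
  induction rem with
  | nil => intro p hp; exact hp
  | cons q t ih =>
    have h0 : remv e (q :: t) = Bool.rec (motive := fun _ => List Item) (q :: remv e t) t
      (Nat.beq q.1 e) := rfl
    rw [h0]
    cases (Nat.beq q.1 e)
    · intro p hp
      rcases List.mem_cons.1 hp with h | h
      · simp [h]
      · exact List.mem_cons_of_mem _ (ih p h)
    · intro p hp
      exact List.mem_cons_of_mem _ hp

theorem allCol_false (d x : Nat) (hx : x < 10) (k : Nat → Bool) (hd : d.testBit x = true)
    (hk : k x = false) : allCol d k = false := by
  have hb : Nat.beq (Nat.land (Nat.shiftRight d x) 1) 1 = true := by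
    rw [land_def, shr_def]
    rw [Nat.testBit, Nat.and_comm] at hd
    have : (d >>> x) &&& 1 = (d >>> x) % 2 := Nat.and_one_is_mod _
    rw [this] at *
    rcases Nat.mod_two_eq_zero_or_one (d >>> x) with h | h
    · simp [h] at hd
    · rw [h]; rfl
  have gen : ∀ n, x < n → (Nat.rec (motive := fun _ => Bool) true
    (fun x ih => Bool.rec (motive := fun _ => Bool) false ih
      (Bool.rec (motive := fun _ => Bool) true (k x)
        (Nat.beq (Nat.land (Nat.shiftRight d x) 1) 1))) n) = false := by
    intro n
    induction n with
    | zero => intro h; omega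
    | succ n ih =>
      intro h
      by_cases hn : x = n
      · subst hn
        simp only [hb, hk]
      · have := ih (by omega)
        simp only [this]
        cases (Bool.rec (motive := fun _ => Bool) true (k n)
          (Nat.beq (Nat.land (Nat.shiftRight d n) 1) 1)) <;> rfl
  exact gen 10 hx

theorem search_sound (E : Nat → Prop) (hc : ∀ g, c g < 10) (fuel : Nat) :
    ∀ (rem : List Item) (A D : Nat), (∀ p ∈ rem, E p.1 ∧ GoodAdj c p.1 p.2) →
      InvA c A → InvD c E D → search fuel rem A D = false := by
  induction fuel with
  | zero => intros; rfl
  | succ n ih =>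
    intro rem A D hr hA hD
    cases rem with
    | nil => rfl
    | cons p t =>
      have h0 : search (n + 1) (p :: t) A D =
        Bool.rec (motive := fun _ => Bool)
          (Prod.rec (motive := fun _ => Bool) (fun e adj =>
            allCol (fldD D e) (fun x =>
              force (updA x A e) (fun A' =>
                propagate x A adj (fun D' => search n (remv e (p :: t)) A' D') D)))
            (pick D p (p :: t)))
          true (anyZero D (p :: t)) := rfl
      rw [h0, anyZero_sound c E D hc hD _ (fun q hq => (hr q hq).1)]
      have hm : pick D p (p :: t) ∈ p :: t := by
        rcases pick_mem D p (p :: t) with h | h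
        · rw [h]; simp
        · exact h
      rcases hpk : pick D p (p :: t) with ⟨e, adj⟩
      rw [hpk] at hm
      obtain ⟨hE, hG⟩ := hr _ hm
      apply allCol_false _ (c e) (hc e)
      · rw [testBit_fldD _ _ _ (hc e)]; exact hD e hE
      · rw [force_eq]
        apply propagate_sound c E A e hc hA _ _ adj hG D hD
        intro D' hD'
        exact ih _ _ _ (fun q hq => hr q (remv_sub _ _ q hq)) (invA_upd c A e hc hA) hD'

end Sound
set_option maxRecDepth 100000 in
theorem search_true : search 22 allItems 0 initDom = true := by
  decide +kernel

def okc (a b c : Nat) : Bool := Nat.testBit okTbl (100 * a + 10 * b + c)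

def cols7 : List Nat := [0, 1, 2, 4, 5, 8, 9]

def ed (a b : Nat) : Nat := if a < b then 7 * a + b else 7 * b + a

theorem okc_bad : ∀ a b c : Fin 10, okc a b c = true →
    (badMask a 0).testBit c = false ∧ (badMask a (b + 1)).testBit c = false := by
  decide +kernel

theorem okc_ne : ∀ a b c : Fin 10, okc a b c = true → a ≠ b := by
  decide +kernel

theorem items_ok : ∀ p ∈ allItems, (p.1 / 7 < p.1 % 7 ∧ p.1 < 49) ∧ ∀ q ∈ p.2,
    ∃ l : Fin 7, l.val ≠ p.1 / 7 ∧ l.val ≠ p.1 % 7 ∧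
      ((q.1 = ed (p.1 / 7) l ∧ q.2 = ed (p.1 % 7) l) ∨
       (q.1 = ed (p.1 % 7) l ∧ q.2 = ed (p.1 / 7) l)) := by
  decide +kernel

theorem init_ok : ∀ i j : Fin 7, i < j → ∀ z : Fin 10,
    okc (cols7.getD i 0) (cols7.getD j 0) z = true →
    initDom.testBit (10 * (7 * i + j) + z) = true := by
  decide +kernel

theorem no7 (k : Fin 7 → Fin 7 → Fin 10) (hs : ∀ i j, k i j = k j i)
    (ht : ∀ i j l, i ≠ j → i ≠ l → j ≠ l → okc (k i j) (k i l) (k j l) = true)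
    (h0 : ∀ i j : Fin 7, i ≠ j → okc (cols7.getD i 0) (cols7.getD j 0) (k i j) = true) : False := by
  let c : Nat → Nat := fun e => (k (Fin.ofNat 7 (e / 7)) (Fin.ofNat 7 (e % 7))).val
  have hc : ∀ g, c g < 10 := fun g => (k _ _).isLt
  have hed : ∀ i j : Fin 7, i ≠ j → c (ed i j) = k i j := by
    intro i j hij
    have h1 : ∀ i j : Fin 7, c (7 * i.val + j.val) = k i j := by
      intro i j
      have e1 : (7 * i.val + j.val) / 7 = i.val := by omega
      have e2 : (7 * i.val + j.val) % 7 = j.val := by omega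
      simp only [c, e1, e2]
      congr 2 <;> simp
    unfold ed
    split_ifs
    · exact h1 i j
    · rw [h1 j i, hs]
  let E : Nat → Prop := fun e => e / 7 < e % 7 ∧ e < 49
  have key := search_sound c E hc 22 allItems 0 initDom ?_ ?_ ?_
  · rw [search_true] at key; exact Bool.noConfusion key
  · intro p hp
    obtain ⟨hE, hq⟩ := items_ok p hp
    refine ⟨hE, fun q hqm => ?_⟩
    obtain ⟨l, h1, h2, h3⟩ := hq q hqm
    obtain ⟨i, hi⟩ : ∃ i : Fin 7, i.val = p.1 / 7 := ⟨⟨p.1 / 7, by omega⟩, rfl⟩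
    obtain ⟨j, hj⟩ : ∃ j : Fin 7, j.val = p.1 % 7 := ⟨⟨p.1 % 7, by omega⟩, rfl⟩
    rw [← hi] at h1 h3 hE
    rw [← hj] at h2 h3 hE
    have hij : i ≠ j := by intro h; rw [h] at hE; omega
    have hil : i ≠ l := by intro h; rw [h] at h1; omega
    have hjl : j ≠ l := by intro h; rw [h] at h2; omega
    have hp1 : p.1 = ed i j := by
      unfold ed; rw [if_pos hE.1]; omega
    have hce : c p.1 = k i j := by rw [hp1, hed i j hij]
    rcases h3 with ⟨h3, h4⟩ | ⟨h3, h4⟩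
    · rw [hce, h3, h4, hed _ _ hil, hed _ _ hjl]
      exact okc_bad _ _ _ (ht i j l hij hil hjl)
    · rw [hce, h3, h4, hed _ _ hil, hed _ _ hjl, hs i j]
      exact okc_bad _ _ _ (ht j i l hij.symm hjl hil)
  · intro f; left; simp [fldA]
  · intro g hg
    obtain ⟨i, hi⟩ : ∃ i : Fin 7, i.val = g / 7 := ⟨⟨g / 7, by have := hg.2; omega⟩, rfl⟩
    obtain ⟨j, hj⟩ : ∃ j : Fin 7, j.val = g % 7 := ⟨⟨g % 7, by omega⟩, rfl⟩
    have hlt : i < j := by have := hg.1; rw [Fin.lt_def]; omega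
    have hgv : g = 7 * i.val + j.val := by omega
    have hce : c g = k i j := by
      rw [← hed i j hlt.ne]; unfold ed; rw [if_pos (Fin.lt_def.1 hlt), ← hgv]
    rw [hce]
    have := init_ok i j hlt (k i j) (h0 i j hlt.ne)
    rw [← hgv] at this
    exact this

theorem perm_ok : ∀ π ∈ permList, (∀ a : Fin 10, π.getD a 0 < 10) ∧
    ∀ a b c : Fin 10, okc a b c = true →
      okc (π.getD a 0) (π.getD b 0) (π.getD c 0) = true := by
  decide +kernel

theorem perm_cover : ∀ p q : Fin 10, p ≠ q → ∃ π ∈ permList, ∀ t : Fin 7,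
    ∃ n : Fin 10, n ≠ p ∧ n ≠ q ∧ π.getD n 0 = cols7.getD t 0 := by
  decide +kernel

theorem cols_inj : ∀ s t : Fin 7, cols7.getD s 0 = cols7.getD t 0 → s = t := by
  decide +kernel

theorem no_coloring (col : Fin 9 → Fin 9 → Fin 10) (hs : ∀ u v, col u v = col v u)
    (ht : ∀ u v w, u ≠ v → u ≠ w → v ≠ w → okc (col u v) (col u w) (col v w) = true) :
    False := by
  classical
  -- the colours at vertex 0
  let S : Finset (Fin 9) := Finset.univ.erase 0
  have hinj : Set.InjOn (col 0) S := by
    intro v hv w hw h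
    by_contra hne
    have hv' : (0 : Fin 9) ≠ v := by simpa [S, eq_comm] using hv
    have hw' : (0 : Fin 9) ≠ w := by simpa [S, eq_comm] using hw
    exact okc_ne _ _ _ (ht 0 v w hv' hw' hne) h
  have hcard : (S.image (col 0)).card = 8 := by
    rw [Finset.card_image_of_injOn hinj]; decide
  have hcompl : ((S.image (col 0))ᶜ).card = 2 := by
    rw [Finset.card_compl, hcard]; rfl
  obtain ⟨p, q, hpq, hc⟩ := Finset.card_eq_two.1 hcompl
  have hex : ∀ n : Fin 10, n ≠ p → n ≠ q → ∃ w : Fin 9, w ≠ 0 ∧ col 0 w = n := by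
    intro n h1 h2
    have : n ∉ (S.image (col 0))ᶜ := by rw [hc]; simp [h1, h2]
    simp only [Finset.mem_compl, not_not, Finset.mem_image] at this
    obtain ⟨w, hw, e⟩ := this
    exact ⟨w, by simpa [S] using hw, e⟩
  obtain ⟨π, hπ, hcov⟩ := perm_cover p q hpq
  obtain ⟨hlt, hok⟩ := perm_ok π hπ
  have hw : ∀ t : Fin 7, ∃ w : Fin 9, w ≠ 0 ∧ π.getD (col 0 w) 0 = cols7.getD t 0 := by
    intro t
    obtain ⟨n, h1, h2, h3⟩ := hcov t
    obtain ⟨w, hw, e⟩ := hex n h1 h2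
    exact ⟨w, hw, by rw [e]; exact h3⟩
  choose w hw0 hwc using hw
  have hwi : ∀ i j, i ≠ j → w i ≠ w j := by
    intro i j hij h
    apply hij
    apply cols_inj
    rw [← hwc i, ← hwc j, h]
  refine no7 (fun i j => ⟨π.getD (col (w i) (w j)) 0, hlt _⟩) ?_ ?_ ?_
  · intro i j; simp only [hs (w i) (w j)]
  · intro i j l h1 h2 h3
    exact hok _ _ _ (ht _ _ _ (hwi _ _ h1) (hwi _ _ h2) (hwi _ _ h3))
  · intro i j h1
    rw [← hwc i, ← hwc j]
    exact hok _ _ _ (ht _ _ _ (hw0 i).symm (hw0 j).symm (hwi _ _ h1))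

/-- `dz k a`: the pairing of the bit vectors `k` and `a` is zero. -/
def dz (k a : Fin 16) : Bool := !(Nat.testBit 27030 (k.val &&& a.val))

def evenW (k : Fin 16) : Bool := !(Nat.testBit 27030 k.val)

def ovoid (k : Fin 16) : Bool := k == 1 || k == 2 || k == 4 || k == 8 || k == 15

def pw (i : Fin 4) : Fin 16 := Fin.ofNat 16 (2 ^ i.val)

def nrm (a : Fin 16) : Fin 8 :=
  Fin.ofNat 8 ((if a.val.testBit 0 then a.val ^^^ 15 else a.val) / 2)

/-- The relation satisfied by the labels of a triangle in the ovoid case. -/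
def Tr (a b c : Fin 16) : Prop :=
  ∀ k : Fin 16, k ≠ 0 → dz k a = true → dz k b = true → dz k c = true → ovoid k = true

instance (a b c : Fin 16) : Decidable (Tr a b c) := by unfold Tr; infer_instance

def good (a : Fin 16) : Bool :=
  a == 1 || a == 2 || a == 4 || a == 8 || a == 3 || a == 5 || a == 9 || a == 6 || a == 10 || a == 12

def enc (a : Fin 16) : Fin 10 :=
  Fin.ofNat 10 ([0, 3, 6, 0, 8, 1, 4, 0, 9, 2, 5, 0, 7, 0, 0, 0].getD a.val 0)

theorem fact_ovoid : ∀ a : Fin 16, a ≠ 0 → ovoid a = true ∨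
    ∃ x y : Fin 16, ovoid x = true ∧ ovoid y = true ∧ x ≠ y ∧ x ^^^ y = a := by decide +kernel

theorem fact_ovoid_pw : ∀ a : Fin 16, ovoid a = true → a = 15 ∨
    ∃ i : Fin 4, a = pw i ∧ Nat.testBit 15 i = true := by decide +kernel

theorem fact_even : ∀ a : Fin 16, a ≠ 0 → evenW a = true → a = 15 ∨
    ∃ i j : Fin 4, pw i ≠ pw j ∧ a = pw i ^^^ pw j ∧ a.val.testBit i = true ∧
      a.val.testBit j = true := by decide +kernel

theorem fact_kill : ∀ a b : Fin 16, ∃ k : Fin 16, k ≠ 0 ∧ evenW k = true ∧ dz k a = true ∧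
    dz k b = true := by decide +kernel

theorem fact_nrm : ∀ a b : Fin 16, nrm a = nrm b → ∀ k : Fin 16, evenW k = true →
    dz k a = dz k b := by decide +kernel

theorem fact_nrm0 : ∀ a : Fin 16, nrm a = 0 → ∀ k : Fin 16, evenW k = true →
    dz k a = true := by decide +kernel

theorem fact_bad : ∀ q : Fin 16, good q = false →
    (Finset.univ.filter (fun b : Fin 16 => ∃ c, Tr q b c)).card ≤ 6 := by decide +kernel

theorem fact_ne : ∀ a b c : Fin 16, Tr a b c → a ≠ b := by decide +kernel

theorem fact_enc : ∀ a b c : Fin 16, good a = true → good b = true → good c = true →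
    Tr a b c → okc (enc a) (enc b) (enc c) = true := by decide +kernel

theorem core (L : Fin 9 → Fin 9 → Fin 16) (hs : ∀ u v, L u v = L v u) (B : Fin 16 → Prop)
    (hB : ∀ k, k ≠ 0 → ∀ u v w, u ≠ v → u ≠ w → v ≠ w → dz k (L u v) = true →
      dz k (L u w) = true → dz k (L v w) = true → B k)
    (hB0 : ∀ k, B k → k ≠ 0)
    (H1 : ∀ a b, B a → B b → a ≠ b → ¬ B (a ^^^ b))
    (H2 : ∀ a, B a → ∀ i : Fin 4, a.val.testBit i = true → B (pw i)) : False := by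
  classical
  by_cases h15 : B 15
  · have hov : ∀ a, ovoid a = true → B a := by
      intro a ha
      rcases fact_ovoid_pw a ha with h | ⟨i, h, hi⟩
      · rw [h]; exact h15
      · rw [h]; exact H2 15 h15 i hi
    have hBo : ∀ a, B a → ovoid a = true := by
      intro a ha
      rcases fact_ovoid a (hB0 a ha) with h | ⟨x, y, hx, hy, hne, h⟩
      · exact h
      · rw [← h] at ha
        exact absurd ha (H1 x y (hov x hx) (hov y hy) hne)
    have hT : ∀ u v w, u ≠ v → u ≠ w → v ≠ w → Tr (L u v) (L u w) (L v w) := by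
      intro u v w h1 h2 h3 k hk ha hb hc
      exact hBo k (hB k hk u v w h1 h2 h3 ha hb hc)
    have hgood : ∀ u v, u ≠ v → good (L u v) = true := by
      intro u v huv
      by_contra hg
      have hcard := fact_bad (L u v) (by simpa using hg)
      let S : Finset (Fin 9) := (Finset.univ.erase u).erase v
      have hS : S.card = 7 := by
        rw [Finset.card_erase_of_mem (by simp [huv.symm]), Finset.card_erase_of_mem (by simp)]
        rfl
      have hmem : ∀ w ∈ S, w ≠ v ∧ w ≠ u := by intro w hw; simpa [S] using hw
      have hle := Finset.card_le_card_of_injOn (s := S) (fun w => L u w)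
        (t := Finset.univ.filter (fun b : Fin 16 => ∃ c, Tr (L u v) b c)) ?_ ?_
      · omega
      · intro w hw
        have := hmem w hw
        simp only [Finset.coe_filter, Finset.mem_univ, true_and, Set.mem_ofPred_eq]
        exact ⟨_, hT u v w huv this.2.symm this.1.symm⟩
      · intro w hw w' hw' h
        by_contra hne
        exact fact_ne _ _ _ (hT u w w' (hmem w hw).2.symm (hmem w' hw').2.symm hne) h
    refine no_coloring (fun u v => enc (L u v)) (fun u v => by simp only [hs u v]) ?_
    intro u v w h1 h2 h3
    exact fact_enc _ _ _ (hgood _ _ h1) (hgood _ _ h2) (hgood _ _ h3) (hT u v w h1 h2 h3)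
  · have hodd : ∀ a, B a → evenW a = false := by
      intro a ha
      rw [← Bool.not_eq_true]
      intro he
      rcases fact_even a (hB0 a ha) he with h | ⟨i, j, hne, h, hi, hj⟩
      · rw [h] at ha; exact h15 ha
      · have h1 := H2 a ha i hi
        have h2 := H2 a ha j hj
        rw [h] at ha
        exact H1 _ _ h1 h2 hne ha
    have hno : ∀ u v w, u ≠ v → u ≠ w → v ≠ w → ∀ k, k ≠ 0 → evenW k = true →
        dz k (L u v) = true → dz k (L u w) = true → dz k (L v w) = true → False := by
      intro u v w h1 h2 h3 k hk he ha hb hc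
      have := hodd k (hB k hk u v w h1 h2 h3 ha hb hc)
      rw [he] at this; exact Bool.noConfusion this
    let S : Finset (Fin 9) := Finset.univ.erase 0
    have hmem : ∀ w ∈ S, (0 : Fin 9) ≠ w := by intro w hw; simpa [S, eq_comm] using hw
    have hle := Finset.card_le_card_of_injOn (s := S) (fun w => nrm (L 0 w))
        (t := Finset.univ.erase (0 : Fin 8)) ?_ ?_
    · have h1 : S.card = 8 := by decide
      have h2 : (Finset.univ.erase (0 : Fin 8)).card = 7 := by decide
      omega
    · intro w hw
      have hw0 := hmem w hw
      simp only [Finset.coe_erase, Finset.coe_univ, Set.mem_sdiff, Set.mem_univ, true_and,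
        Set.mem_singleton_iff]
      intro h
      obtain ⟨w', h1, h2⟩ : ∃ w' : Fin 9, 0 ≠ w' ∧ w ≠ w' := by
        have hall : ∀ w : Fin 9, ∃ w' : Fin 9, 0 ≠ w' ∧ w ≠ w' := by decide
        exact hall w
      obtain ⟨k, hk, he, ha, hb⟩ := fact_kill (L 0 w') (L w w')
      exact hno 0 w w' hw0 h1 h2 k hk he (fact_nrm0 _ h k he) ha hb
    · intro w hw w' hw' h
      by_contra hne
      obtain ⟨k, hk, he, ha, hb⟩ := fact_kill (L 0 w) (L w w')
      exact hno 0 w w' (hmem w hw) (hmem w' hw') hne k hk he ha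
        ((fact_nrm _ _ h k he) ▸ ha) hb

def enc4 (x0 x1 x2 x3 : ZMod 2) : Fin 16 :=
  Fin.ofNat 16 (x0.val + 2 * x1.val + 4 * x2.val + 8 * x3.val)

def bt (k : Fin 16) (i : Fin 4) : ZMod 2 := if k.val.testBit i then 1 else 0

theorem dz_enc4 : ∀ (k : Fin 16) (x0 x1 x2 x3 : ZMod 2), dz k (enc4 x0 x1 x2 x3) = true ↔
    bt k 0 * x0 + bt k 1 * x1 + bt k 2 * x2 + bt k 3 * x3 = 0 := by
  decide +kernel

theorem bt_xor : ∀ (a b : Fin 16) (i : Fin 4), bt (a ^^^ b) i = bt a i + bt b i := by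
  decide +kernel

theorem bt_pw : ∀ i j : Fin 4, bt (pw i) j = if j = i then 1 else 0 := by
  decide +kernel

theorem bt_inj : ∀ a b : Fin 16, (∀ i, bt a i = bt b i) → a = b := by
  decide +kernel

theorem bt_zero : ∀ i : Fin 4, bt 0 i = 0 := by decide +kernel

theorem bt_ne : ∀ (a : Fin 16) (i : Fin 4), a.val.testBit i = true → bt a i ≠ 0 := by
  decide +kernel

/-- `G` vanishes on some triangle. -/
def VanTri (G : Kvecsp 9) : Prop :=
  ∃ u v w : Fin 9, ∃ (h1 : u ≠ v) (h2 : u ≠ w) (h3 : v ≠ w),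
    G (edg u v h1) = 0 ∧ G (edg u w h2) = 0 ∧ G (edg v w h3) = 0

theorem hasTriangle_agr (G₁ G₂ : Kvecsp 9) (h : VanTri (G₁ + G₂)) : HasTriangle (agr G₁ G₂) := by
  obtain ⟨u, v, w, h1, h2, h3, a, b, c⟩ := h
  simp only [Pi.add_apply] at a b c
  exact ⟨u, v, w, h1, h2, h3, ⟨h1, by simp [agr, a]⟩, ⟨h2, by simp [agr, b]⟩,
    ⟨h3, by simp [agr, c]⟩⟩

theorem edg_symm (u v : Fin 9) (h : u ≠ v) : edg u v h = edg v u h.symm := by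
  apply Subtype.ext
  exact Sym2.eq_swap

theorem sumfree (V : Submodule (ZMod 2) (Kvecsp 9)) (hV : Module.finrank (ZMod 2) V = 4)
    (hU : UsefulForTriangles (V : Set (Kvecsp 9))) (x y : V) (hx : x ≠ 0) (hy : y ≠ 0)
    (hxy : x ≠ y) (tx : VanTri x) (ty : VanTri y) : ¬ VanTri ((x + y : V) : Kvecsp 9) := by
  intro txy
  obtain ⟨m, hm, hc, hS⟩ := hU
  have hcard : (V : Set (Kvecsp 9)).ncard = 2 ^ 4 := by
    have := Module.natCard_eq_pow_finrank (K := ZMod 2) (V := V)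
    rw [hV, Nat.card_zmod] at this
    exact this
  have hm4 : m = 4 := by
    rw [hcard] at hc
    exact (Nat.pow_right_injective (le_refl 2) hc).symm
  subst hm4
  have hx' : (x : Kvecsp 9) ≠ 0 := fun h => hx (Subtype.ext h)
  have hy' : (y : Kvecsp 9) ≠ 0 := fun h => hy (Subtype.ext h)
  have hxy' : (x : Kvecsp 9) ≠ y := fun h => hxy (Subtype.ext h)
  obtain ⟨G₁, m1, G₂, m2, hne, htf⟩ := hS {0, (x : Kvecsp 9), (y : Kvecsp 9)} (by
      intro z hz
      rcases hz with rfl | rfl | rfl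
      · exact V.zero_mem
      · exact x.2
      · exact y.2) (by
      exact Set.ncard_eq_three.2 ⟨0, (x : Kvecsp 9), (y : Kvecsp 9), hx'.symm, hy'.symm, hxy', rfl⟩)
  apply htf
  apply hasTriangle_agr
  have txy' : VanTri ((x : Kvecsp 9) + y) := txy
  rcases m1 with rfl | rfl | rfl <;> rcases m2 with rfl | rfl | rfl
  · exact absurd rfl hne
  · rwa [zero_add]
  · rwa [zero_add]
  · rwa [add_zero]
  · exact absurd rfl hne
  · exact txy'
  · rwa [add_zero]
  · rwa [add_comm]
  · exact absurd rfl hne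

theorem exists_basis (V : Submodule (ZMod 2) (Kvecsp 9)) (hV : Module.finrank (ZMod 2) V = 4)
    (T : Set V) : ∃ e : Module.Basis (Fin 4) (ZMod 2) V, ∀ x ∈ T, ∀ i, e.repr x i ≠ 0 → e i ∈ T := by
  obtain ⟨b, hbT, -, hTb, hli⟩ := exists_linearIndepOn_id_extension (K := ZMod 2)
    (s := (∅ : Set V)) (t := T) (linearIndepOn_empty _ _) (Set.empty_subset _)
  let e0 := Module.Basis.extend hli
  have hfin : Module.finrank (ZMod 2) V = Nat.card (hli.extend (Set.subset_univ b)) :=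
    Module.finrank_eq_nat_card_basis e0
  have : Finite (hli.extend (Set.subset_univ b)) := Module.Finite.finite_basis e0
  let eq : (hli.extend (Set.subset_univ b)) ≃ Fin 4 :=
    (Finite.equivFinOfCardEq (by rw [← hfin, hV]))
  refine ⟨e0.reindex eq, fun x hx i hi => ?_⟩
  have hsub : b ⊆ e0.reindex eq '' {i | e0.reindex eq i ∈ b} := by
    intro y hy
    have hy' := hli.subset_extend (Set.subset_univ b) hy
    have : e0.reindex eq (eq ⟨y, hy'⟩) = y := by
      simp [e0]
    exact ⟨eq ⟨y, hy'⟩, by rw [Set.mem_ofPred_eq, this]; exact hy, this⟩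
  have hx2 := Submodule.span_mono hsub (hTb hx)
  have := Module.Basis.repr_support_subset_of_mem_span _ _ hx2
  exact hbT (this (by simpa using hi))

/-- No four-dimensional subspace of the space of graphs on 9 vertices is useful
for triangles. -/
theorem stmt8 : ¬ ∃ V : Submodule (ZMod 2) (Kvecsp 9),
    Module.finrank (ZMod 2) V = 4 ∧ UsefulForTriangles (V : Set (Kvecsp 9)) := by
  rintro ⟨V, hV, hU⟩
  obtain ⟨e, he⟩ := exists_basis V hV {x : V | x ≠ 0 ∧ VanTri x}
  let G : Fin 16 → V := fun k => ∑ i, bt k i • e i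
  have hrepr : ∀ k i, e.repr (G k) i = bt k i := by
    intro k i
    simp only [G, e.repr_sum_self]
  have hGval : ∀ k d, (G k : Kvecsp 9) d = bt k 0 * (e 0 : Kvecsp 9) d +
      bt k 1 * (e 1 : Kvecsp 9) d + bt k 2 * (e 2 : Kvecsp 9) d + bt k 3 * (e 3 : Kvecsp 9) d := by
    intro k d
    simp [G, Fin.sum_univ_four]
  have hGne : ∀ a b, a ≠ b → G a ≠ G b := by
    intro a b hab h
    apply hab
    apply bt_inj
    intro i
    rw [← hrepr, ← hrepr, h]
  have hG0 : G 0 = 0 := by simp [G, bt_zero]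
  have hGx : ∀ a b, G (a ^^^ b) = G a + G b := by
    intro a b
    simp only [G, bt_xor, add_smul, Finset.sum_add_distrib]
  have hGp : ∀ i, G (pw i) = e i := by
    intro i
    simp [G, bt_pw]
  let L : Fin 9 → Fin 9 → Fin 16 := fun u v =>
    if h : u ≠ v then enc4 ((e 0 : Kvecsp 9) (edg u v h)) ((e 1 : Kvecsp 9) (edg u v h))
      ((e 2 : Kvecsp 9) (edg u v h)) ((e 3 : Kvecsp 9) (edg u v h)) else 0
  have hdz : ∀ k u v (h : u ≠ v), dz k (L u v) = true → (G k : Kvecsp 9) (edg u v h) = 0 := by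
    intro k u v h hd
    simp only [L, dif_pos h] at hd
    rw [hGval]
    exact (dz_enc4 _ _ _ _ _).1 hd
  refine core L ?_ (fun k => k ≠ 0 ∧ VanTri (G k)) ?_ ?_ ?_ ?_
  · intro u v
    by_cases h : u = v
    · rw [h]
    · simp only [L, dif_pos (show u ≠ v from h), dif_pos (show v ≠ u from Ne.symm h)]
      rw [edg_symm u v h]
  · intro k hk u v w h1 h2 h3 a b c
    exact ⟨hk, u, v, w, h1, h2, h3, hdz _ _ _ h1 a, hdz _ _ _ h2 b, hdz _ _ _ h3 c⟩
  · intro k hk; exact hk.1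
  · rintro a b ⟨ha, ta⟩ ⟨hb, tb⟩ hab ⟨-, tab⟩
    rw [hGx] at tab
    refine sumfree V hV hU (G a) (G b) ?_ ?_ (hGne a b hab) ta tb tab
    · rw [← hG0]; exact hGne a 0 ha
    · rw [← hG0]; exact hGne b 0 hb
  · rintro a ⟨ha, ta⟩ i hi
    have h1 := he (G a) ⟨by rw [← hG0]; exact hGne a 0 ha, ta⟩ i (by
      rw [hrepr]; exact bt_ne a i hi)
    refine ⟨?_, ?_⟩
    · intro h
      apply h1.1
      rw [← hGp, h, hG0]
    · rw [hGp]; exact h1.2
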